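/- Consider the problem ${\rm APP} = \{{\rm APP}_{\infty,d}\}_{d \in \mathbb{N}}$ in the worst case setting for the absolute or normalized error criterion $\star \in \{{\rm ABS}, {\rm NOR}\}$. Then ${\rm APP}$ is algebraically polynomially tractable (ALG-PT) for $\Lambda^{\rm all}$ if and only if it is ALG-PT for $\Lambda^{\rm std}$. -/

import Mathlib

open Filter
open scoped ENNReal NNReal

noncomputable section

/-- Coefficient space: `ℓ²` sequences indexed by `ℤ^d`.  An element `u` represents the
function `f ∈ H^ω(𝕋^d)` with Fourier coefficients `f̂(k) = u k / ω k`, so that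
`‖u‖_{ℓ²} = ‖f‖_{H^ω}`. -/
abbrev Coef (d : ℕ) := lp (fun _ : Fin d → ℤ => ℂ) 2

/-- The periodic function represented by the coefficients `u`:
`f(x) = ∑_{k ∈ ℤ^d} (u k / ω k) e^{2πi k·x}`. -/
def torusFn {d : ℕ} (ω : (Fin d → ℤ) → ℝ) (u : Coef d) (x : Fin d → ℝ) : ℂ :=
  ∑' k : Fin d → ℤ,
    ((ω k : ℂ))⁻¹ * u k * Complex.exp (2 * Real.pi * Complex.I * ∑ j, (k j : ℂ) * (x j : ℂ))

/-- The torus `𝕋^d`, modelled as the cube `[0,1]^d`. -/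
def cube (d : ℕ) : Set (Fin d → ℝ) := {x | ∀ j, x j ∈ Set.Icc (0 : ℝ) 1}

/-- Standard information: point-evaluation functionals `f ↦ f(x)`. -/
def stdInfo {d : ℕ} (ω : (Fin d → ℤ) → ℝ) : Set (Coef d → ℂ) :=
  {L | ∃ x ∈ cube d, L = fun u => torusFn ω u x}

/-- General linear information: all continuous linear functionals on `H^ω`. -/
def allInfo (d : ℕ) : Set (Coef d → ℂ) := {L | ∃ T : Coef d →L[ℂ] ℂ, L = ⇑T}

/-- The `n`-th minimal worst case error `e(n, APP_{∞,d}; Λ)` of `L_∞`-approximation on the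
unit ball of `H^ω(𝕋^d)`, using algorithms `f ↦ φ(L₁ f, …, Lₙ f)` with `Lᵢ ∈ Λ`. -/
def wcErr {d : ℕ} (ω : (Fin d → ℤ) → ℝ) (Λ : Set (Coef d → ℂ)) (n : ℕ) : ℝ≥0∞ :=
  ⨅ (L : Fin n → Coef d → ℂ) (_ : ∀ i, L i ∈ Λ) (φ : (Fin n → ℂ) → (Fin d → ℝ) → ℂ),
    ⨆ (u : Coef d) (_ : ‖u‖ ≤ 1) (x : Fin d → ℝ) (_ : x ∈ cube d),
      (‖torusFn ω u x - φ (fun i => L i u) x‖₊ : ℝ≥0∞)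

/-- The initial error `e(0, APP_{∞,d}) = sup_{‖f‖_{H^ω} ≤ 1} ‖f‖_∞`. -/
def initErr {d : ℕ} (ω : (Fin d → ℤ) → ℝ) : ℝ≥0∞ :=
  ⨆ (u : Coef d) (_ : ‖u‖ ≤ 1) (x : Fin d → ℝ) (_ : x ∈ cube d),
    (‖torusFn ω u x‖₊ : ℝ≥0∞)

/-- The error criterion: absolute (ABS) or normalized (NOR). -/
inductive Crit | ABS | NOR

/-- `CRI_d`: the normalizing quantity of the error criterion. -/
def CRI {d : ℕ} (ω : (Fin d → ℤ) → ℝ) : Crit → ℝ≥0∞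
  | Crit.ABS => 1
  | Crit.NOR => initErr ω

/-- The information complexity `n^⋆(ε, d; Λ)`. -/
def infoComp {d : ℕ} (ω : (Fin d → ℤ) → ℝ) (Λ : Set (Coef d → ℂ)) (crit : Crit) (ε : ℝ) : ℕ :=
  sInf {n : ℕ | wcErr ω Λ n ≤ ENNReal.ofReal ε * CRI ω crit}

/-- Algebraic strong polynomial tractability of the family of information complexities `nc`. -/
def ALGSPT (nc : ℕ → ℝ → ℕ) : Prop :=
  ∃ C > (0:ℝ), ∃ p ≥ (0:ℝ), ∀ d : ℕ, 0 < d → ∀ ε ∈ Set.Ioo (0:ℝ) 1,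
    (nc d ε : ℝ) ≤ C * ε ^ (-p)

/-- The exponent of algebraic strong polynomial tractability. -/
def ALGSPTexp (nc : ℕ → ℝ → ℕ) : ℝ :=
  sInf {p : ℝ | 0 ≤ p ∧ ∃ C > (0:ℝ), ∀ d : ℕ, 0 < d → ∀ ε ∈ Set.Ioo (0:ℝ) 1,
    (nc d ε : ℝ) ≤ C * ε ^ (-p)}

/-- Algebraic polynomial tractability. -/
def ALGPT (nc : ℕ → ℝ → ℕ) : Prop :=
  ∃ C > (0:ℝ), ∃ p ≥ (0:ℝ), ∃ q ≥ (0:ℝ), ∀ d : ℕ, 0 < d → ∀ ε ∈ Set.Ioo (0:ℝ) 1,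
    (nc d ε : ℝ) ≤ C * (d : ℝ) ^ q * ε ^ (-p)

/-- Algebraic quasi-polynomial tractability. -/
def ALGQPT (nc : ℕ → ℝ → ℕ) : Prop :=
  ∃ C > (0:ℝ), ∃ t ≥ (0:ℝ), ∀ d : ℕ, 0 < d → ∀ ε ∈ Set.Ioo (0:ℝ) 1,
    (nc d ε : ℝ) ≤ C * Real.exp (t * (1 + Real.log d) * (1 + Real.log ε⁻¹))

/-- The exponent of algebraic quasi-polynomial tractability. -/
def ALGQPTexp (nc : ℕ → ℝ → ℕ) : ℝ :=
  sInf {t : ℝ | 0 ≤ t ∧ ∃ C > (0:ℝ), ∀ d : ℕ, 0 < d → ∀ ε ∈ Set.Ioo (0:ℝ) 1,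
    (nc d ε : ℝ) ≤ C * Real.exp (t * (1 + Real.log d) * (1 + Real.log ε⁻¹))}

/-- Exponential quasi-polynomial tractability. -/
def EXPQPT (nc : ℕ → ℝ → ℕ) : Prop :=
  ∃ C > (0:ℝ), ∃ t ≥ (0:ℝ), ∀ d : ℕ, 0 < d → ∀ ε ∈ Set.Ioo (0:ℝ) 1,
    (nc d ε : ℝ) ≤ C * Real.exp (t * (1 + Real.log d) * (1 + Real.log (Real.log ε⁻¹ + 1)))

/-- The exponent of exponential quasi-polynomial tractability. -/
def EXPQPTexp (nc : ℕ → ℝ → ℕ) : ℝ :=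
  sInf {t : ℝ | 0 ≤ t ∧ ∃ C > (0:ℝ), ∀ d : ℕ, 0 < d → ∀ ε ∈ Set.Ioo (0:ℝ) 1,
    (nc d ε : ℝ) ≤ C * Real.exp (t * (1 + Real.log d) * (1 + Real.log (Real.log ε⁻¹ + 1)))}

/-- `lim_{ε⁻¹ + d → ∞} (log nc(d, ε)) / den(d, ε) = 0`. -/
def WTlim (den : ℕ → ℝ → ℝ) (nc : ℕ → ℝ → ℕ) : Prop :=
  ∀ δ > (0:ℝ), ∃ M : ℝ, ∀ d : ℕ, 0 < d → ∀ ε ∈ Set.Ioo (0:ℝ) 1,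
    M ≤ ε⁻¹ + d → |Real.log (nc d ε) / den d ε| < δ

/-- Algebraic `(s,t)`-weak tractability; `ALGWTst 1 1` is algebraic weak tractability. -/
def ALGWTst (s t : ℝ) (nc : ℕ → ℝ → ℕ) : Prop :=
  WTlim (fun d ε => ε ^ (-s) + (d : ℝ) ^ t) nc

/-- Algebraic uniform weak tractability. -/
def ALGUWT (nc : ℕ → ℝ → ℕ) : Prop := ∀ α > (0:ℝ), ∀ β > (0:ℝ), ALGWTst α β nc

/-- Exponential `(s,t)`-weak tractability; `EXPWTst 1 1` is exponential weak tractability. -/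
def EXPWTst (s t : ℝ) (nc : ℕ → ℝ → ℕ) : Prop :=
  WTlim (fun d ε => (1 + Real.log ε⁻¹) ^ s + (d : ℝ) ^ t) nc

/-- Exponential uniform weak tractability. -/
def EXPUWT (nc : ℕ → ℝ → ℕ) : Prop := ∀ α > (0:ℝ), ∀ β > (0:ℝ), EXPWTst α β nc


section abstractPart

variable {H : Type*} [NormedAddCommGroup H] [InnerProductSpace ℂ H]

def gramM {N : ℕ} (K : Fin N → H) : Matrix (Fin N) (Fin N) ℂ :=
  Matrix.of fun i j => inner ℂ (K i) (K j)

def dualV {N : ℕ} (K : Fin N → H) (i : Fin N) : H :=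
  ∑ j, ((gramM K)⁻¹ j i) • K j

lemma inner_dualV {N : ℕ} (K : Fin N → H) (hG : (gramM K).det ≠ 0) (l i : Fin N) :
    inner ℂ (K l) (dualV K i) = if l = i then 1 else 0 := by
  have h : (gramM K) * (gramM K)⁻¹ = 1 := Matrix.mul_nonsing_inv _ (isUnit_iff_ne_zero.mpr hG)
  have h2 := congrFun (congrFun h l) i
  rw [Matrix.mul_apply, Matrix.one_apply] at h2
  rw [← h2, dualV, inner_sum]
  refine Finset.sum_congr rfl fun j _ => ?_
  rw [inner_smul_right, mul_comm]; rfl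

lemma inner_dualV' {N : ℕ} (K : Fin N → H) (hG : (gramM K).det ≠ 0) (i l : Fin N) :
    inner ℂ (dualV K i) (K l) = if l = i then 1 else 0 := by
  rw [← inner_conj_symm, inner_dualV K hG]
  split_ifs <;> simp

lemma norm_dualV_sq {N : ℕ} (K : Fin N → H) (hG : (gramM K).det ≠ 0) (i : Fin N) :
    ‖dualV K i‖ ^ 2 = ‖(gramM K)⁻¹ i i‖ := by
  have h : inner ℂ (dualV K i) (dualV K i) = (starRingEnd ℂ) ((gramM K)⁻¹ i i) := by
    conv_lhs => arg 2; rw [dualV]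
    rw [sum_inner]
    simp_rw [inner_smul_left, inner_dualV K hG]
    simp
  have h2 := congrArg norm h
  rw [RCLike.norm_conj] at h2
  rw [← h2, inner_self_eq_norm_sq_to_K]
  simp

lemma expand_dualV {N : ℕ} (K : Fin N → H) (hG : (gramM K).det ≠ 0) (i : Fin N) :
    K i = ∑ j, (gramM K j i) • dualV K j := by
  have h : (gramM K)⁻¹ * (gramM K) = 1 := Matrix.nonsing_inv_mul _ (isUnit_iff_ne_zero.mpr hG)
  simp_rw [dualV, Finset.smul_sum, smul_smul]
  rw [Finset.sum_comm]
  simp_rw [← Finset.sum_smul]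
  have h2 : ∀ l, ∑ j, gramM K j i * (gramM K)⁻¹ l j = if l = i then 1 else 0 := by
    intro l
    have h2 := congrFun (congrFun h l) i
    rw [Matrix.mul_apply, Matrix.one_apply] at h2
    rw [← h2]
    exact Finset.sum_congr rfl fun j _ => mul_comm _ _
  simp_rw [h2]
  simp

def projK {N : ℕ} (K : Fin N → H) (v : H) : H := ∑ i, (inner ℂ (dualV K i) v) • K i

lemma projK_norm {N : ℕ} (K : Fin N → H) (hG : (gramM K).det ≠ 0) (v : H) :
    ‖projK K v‖ ≤ ‖v‖ := by
  have h1 : ∀ j, inner ℂ (dualV K j) (v - projK K v) = 0 := by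
    intro j
    rw [inner_sub_right, projK, inner_sum]
    simp_rw [inner_smul_right, inner_dualV' K hG]
    simp
  have h2 : ∀ i, inner ℂ (K i) (v - projK K v) = 0 := by
    intro i
    rw [expand_dualV K hG i, sum_inner]
    simp [inner_smul_left, h1]
  have h3 : inner ℂ (projK K v) (v - projK K v) = 0 := by
    conv_lhs => arg 2; rw [projK]
    rw [sum_inner]
    simp [inner_smul_left, h2]
  have h4 := norm_add_sq_eq_norm_sq_add_norm_sq_of_inner_eq_zero _ _ h3
  rw [add_sub_cancel] at h4
  nlinarith [norm_nonneg v, norm_nonneg (projK K v), norm_nonneg (v - projK K v)]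

lemma trace_bound {N n : ℕ} (K : Fin N → H) (hG : (gramM K).det ≠ 0)
    (V : Submodule ℂ H) [FiniteDimensional ℂ V] (hV : Module.finrank ℂ V ≤ n)
    (β E : ℝ) (hβ : ∀ i, ‖dualV K i‖ ≤ β) (hE : ∀ i, ‖K i - V.starProjection (K i)‖ ≤ E)
    (hβ0 : 0 ≤ β) :
    (N : ℝ) ≤ n + N * (β * E) := by
  have h1 : (N : ℂ) = ∑ i, inner ℂ (dualV K i) (V.starProjection (K i)) +
      ∑ i, inner ℂ (dualV K i) (K i - V.starProjection (K i)) := by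
    rw [← Finset.sum_add_distrib]
    simp_rw [← inner_add_right, add_sub_cancel, inner_dualV' K hG]
    simp
  have h2 : ‖∑ i, inner ℂ (dualV K i) (K i - V.starProjection (K i))‖ ≤ N * (β * E) := by
    refine (norm_sum_le _ _).trans ?_
    refine (Finset.sum_le_sum (g := fun _ => β * E) fun i _ => ?_).trans (by simp)
    refine (norm_inner_le_norm _ _).trans ?_
    exact mul_le_mul (hβ i) (hE i) (norm_nonneg _) hβ0
  have h3 : ∑ i, inner ℂ (dualV K i) (V.starProjection (K i)) =
      ∑ l, inner ℂ ((stdOrthonormalBasis ℂ V l : V) : H)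
        (projK K ((stdOrthonormalBasis ℂ V l : V) : H)) := by
    simp_rw [(stdOrthonormalBasis ℂ V).starProjection_eq_sum_rankOne, projK,
      ContinuousLinearMap.sum_apply, InnerProductSpace.rankOne_apply, inner_sum,
      inner_smul_right]
    rw [Finset.sum_comm]
    refine Finset.sum_congr rfl fun l _ => Finset.sum_congr rfl fun i _ => mul_comm _ _
  have h4 : ‖∑ i, inner ℂ (dualV K i) (V.starProjection (K i))‖ ≤ n := by
    rw [h3]
    refine (norm_sum_le _ _).trans ?_
    refine (Finset.sum_le_sum (g := fun _ => (1:ℝ)) fun i _ => ?_).trans ?_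
    · refine (norm_inner_le_norm _ _).trans ?_
      have hb : ‖((stdOrthonormalBasis ℂ V i : V) : H)‖ = 1 :=
        (stdOrthonormalBasis ℂ V).orthonormal.1 i
      have := projK_norm K hG ((stdOrthonormalBasis ℂ V i : V) : H)
      rw [hb] at this ⊢
      linarith
    · simpa using hV
  have h5 := congrArg norm h1
  rw [Complex.norm_natCast] at h5
  exact h5.le.trans ((norm_add_le _ _).trans (add_le_add h4 h2))

lemma inner_last_le {m : ℕ} (K : Fin (m+1) → H) (hG : (gramM K).det ≠ 0) (v : H)
    (hv : ∀ i : Fin m, inner ℂ (K i.castSucc) v = 0) :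
    ‖dualV K (Fin.last m)‖ * ‖inner ℂ (K (Fin.last m)) v‖ ≤ ‖v‖ := by
  have h1 : inner ℂ (dualV K (Fin.last m)) v =
      (starRingEnd ℂ) ((gramM K)⁻¹ (Fin.last m) (Fin.last m)) * inner ℂ (K (Fin.last m)) v := by
    conv_lhs => rw [dualV]
    rw [sum_inner, Fin.sum_univ_castSucc]
    simp [inner_smul_left, hv]
  have h2 := norm_inner_le_norm (𝕜 := ℂ) (dualV K (Fin.last m)) v
  rw [h1, norm_mul, RCLike.norm_conj, ← norm_dualV_sq K hG, sq, mul_assoc] at h2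
  have hpos : 0 < ‖dualV K (Fin.last m)‖ := by
    rw [norm_pos_iff]
    intro h0
    have := inner_dualV K hG (Fin.last m) (Fin.last m)
    rw [h0] at this
    simp at this
  exact le_of_mul_le_mul_left h2 hpos

lemma inner_last_zero {m : ℕ} (K : Fin (m+1) → H) (hG : (gramM K).det = 0)
    (hG' : (gramM fun i : Fin m => K i.castSucc).det ≠ 0) (v : H)
    (hv : ∀ i : Fin m, inner ℂ (K i.castSucc) v = 0) :
    inner ℂ (K (Fin.last m)) v = 0 := by
  obtain ⟨c, hc0, hc⟩ := Matrix.exists_mulVec_eq_zero_iff.mpr hG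
  have hin : ∀ i, inner ℂ (K i) (∑ j, c j • K j) = 0 := by
    intro i
    have := congrFun hc i
    rw [inner_sum]
    simp only [Matrix.mulVec, dotProduct, Pi.zero_apply] at this
    rw [← this]
    refine Finset.sum_congr rfl fun j _ => ?_
    rw [inner_smul_right, mul_comm]; rfl
  have hz : ∑ j, c j • K j = 0 := by
    rw [← inner_self_eq_zero (𝕜 := ℂ)]
    conv_lhs => rw [sum_inner]
    simp only [inner_smul_left, hin, mul_zero, Finset.sum_const_zero]
  by_cases hl : c (Fin.last m) = 0
  · exfalso
    apply hG'
    refine Matrix.exists_mulVec_eq_zero_iff.mp ⟨fun i => c i.castSucc, ?_, ?_⟩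
    · intro h0
      apply hc0
      funext i
      refine Fin.lastCases hl (fun j => congrFun h0 j) i
    · funext i
      have := congrFun hc i.castSucc
      simp only [Matrix.mulVec, dotProduct, Pi.zero_apply, Fin.sum_univ_castSucc, hl, mul_zero,
        add_zero] at this ⊢
      exact this
  · have h : inner ℂ (∑ j, c j • K j) v = 0 := by rw [hz, inner_zero_left]
    rw [sum_inner, Fin.sum_univ_castSucc] at h
    simp only [inner_smul_left, hv, mul_zero, Finset.sum_const_zero, zero_add] at h
    rcases mul_eq_zero.mp h with h | h
    · exact absurd (by simpa using h) hl
    · exact h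

lemma norm_dualV_le {m : ℕ} (K : Fin (m+1) → H) (hG : (gramM K).det ≠ 0)
    (hmax : ∀ i : Fin (m+1), ‖(gramM (K ∘ i.succAbove)).det‖ ≤
      ‖(gramM fun i : Fin m => K i.castSucc).det‖) (i : Fin (m+1)) :
    ‖dualV K i‖ ≤ ‖dualV K (Fin.last m)‖ := by
  have key : ∀ i : Fin (m+1), ‖dualV K i‖ ^ 2 =
      ‖(gramM K).det‖⁻¹ * ‖(gramM (K ∘ i.succAbove)).det‖ := by
    intro i
    rw [norm_dualV_sq K hG, Matrix.inv_def, Matrix.smul_apply, smul_eq_mul, norm_mul,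
      Ring.inverse_eq_inv', norm_inv, Matrix.adjugate_fin_succ_eq_det_submatrix, norm_mul]
    simp only [norm_pow, norm_neg, norm_one, one_pow, one_mul]
    rfl
  have hlast : K ∘ (Fin.last m).succAbove = fun i : Fin m => K i.castSucc := by
    funext j; simp
  refine le_of_sq_le_sq ?_ (norm_nonneg _)
  rw [key, key, hlast]
  exact mul_le_mul_of_nonneg_left (hmax i) (by positivity)

/-- the combined estimate -/
lemma std_of_all {α : Type*} [TopologicalSpace α] (κ : α → H) (hκ : Continuous κ) (S : Set α)
    (hS : IsCompact S) (hne : S.Nonempty) (n : ℕ) :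
    ∃ k ≤ 2 * n, ∃ X : Fin k → α, (∀ i, X i ∈ S) ∧
      ∀ (V : Submodule ℂ H) (_ : FiniteDimensional ℂ V) (E : ℝ), Module.finrank ℂ V ≤ n →
        (∀ x ∈ S, ‖κ x - V.starProjection (κ x)‖ ≤ E) →
        ∀ v, (∀ i, inner ℂ (κ (X i)) v = 0) → ∀ x ∈ S, ‖inner ℂ (κ x) v‖ ≤ 2 * E * ‖v‖ := by
  have hE0 : ∀ (V : Submodule ℂ H) (_ : FiniteDimensional ℂ V) (E : ℝ),
      (∀ x ∈ S, ‖κ x - V.starProjection (κ x)‖ ≤ E) → 0 ≤ E := by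
    intro V _ E h
    obtain ⟨x, hx⟩ := hne
    exact (norm_nonneg _).trans (h x hx)
  by_cases hP : ∃ X : Fin (2 * n) → α, (∀ i, X i ∈ S) ∧ (gramM fun i => κ (X i)).det ≠ 0
  · have hc : IsCompact (Set.pi Set.univ fun _ : Fin (2 * n) => S) := isCompact_univ_pi fun _ => hS
    have hcont : Continuous fun X : Fin (2 * n) → α => ‖(gramM fun i => κ (X i)).det‖ := by
      refine Continuous.norm (Continuous.matrix_det ?_)
      refine continuous_matrix fun i j => ?_
      simp only [gramM, Matrix.of_apply]
      fun_prop
    obtain ⟨X0, hX0, hX0d⟩ := hP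
    obtain ⟨X, hX, hXm⟩ := hc.exists_isMaxOn ⟨X0, fun i _ => hX0 i⟩ hcont.continuousOn
    have hXS : ∀ i, X i ∈ S := fun i => hX i trivial
    have hXd : (gramM fun i => κ (X i)).det ≠ 0 := by
      have h : ‖(gramM fun i => κ (X0 i)).det‖ ≤ ‖(gramM fun i => κ (X i)).det‖ :=
        hXm (show X0 ∈ _ from fun i _ => hX0 i)
      exact norm_pos_iff.mp (lt_of_lt_of_le (norm_pos_iff.mpr hX0d) h)
    refine ⟨2 * n, le_rfl, X, hXS, ?_⟩
    intro V hVf E hV hE v hv x hx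
    have hE1 := hE0 V hVf E hE
    let Y : Fin (2 * n + 1) → α := Fin.snoc X x
    have hYS : ∀ i, Y i ∈ S := by
      intro i
      refine Fin.lastCases ?_ (fun j => ?_) i
      · simpa [Y] using hx
      · simpa [Y] using hXS j
    have hYc : (fun i : Fin (2 * n) => κ (Y i.castSucc)) = fun i => κ (X i) := by
      funext i; simp [Y]
    have hYv : ∀ i : Fin (2 * n), inner ℂ (κ (Y i.castSucc)) v = 0 := by
      intro i; simpa [Y] using hv i
    have hYl : κ (Y (Fin.last _)) = κ x := by simp [Y]
    by_cases hd : (gramM fun i => κ (Y i)).det = 0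
    · have h := inner_last_zero (fun i => κ (Y i)) hd (by rw [hYc]; exact hXd) v hYv
      rw [hYl] at h
      rw [h, norm_zero]
      positivity
    · have h1 := inner_last_le (fun i => κ (Y i)) hd v hYv
      have h2 := norm_dualV_le (fun i => κ (Y i)) hd (by
        intro i
        rw [hYc]
        exact hXm (show (fun j => Y (i.succAbove j)) ∈ _ from fun j _ => hYS _))
      have h3 := trace_bound (fun i => κ (Y i)) hd V hV _ E h2 (fun i => hE _ (hYS i))
        (norm_nonneg _)
      simp only [hYl] at h1
      set β := ‖dualV (fun i => κ (Y i)) (Fin.last (2 * n))‖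
      have hβ : 0 ≤ β := norm_nonneg _
      push_cast at h3
      have hn : (0:ℝ) ≤ n := Nat.cast_nonneg n
      have h4 : 1 ≤ 2 * (β * E) := by
        by_contra hlt
        push Not at hlt
        nlinarith
      have h5 : (0:ℝ) ≤ ‖inner ℂ (κ x) v‖ := norm_nonneg _
      calc ‖inner ℂ (κ x) v‖ = 1 * ‖inner ℂ (κ x) v‖ := (one_mul _).symm
        _ ≤ (2 * (β * E)) * ‖inner ℂ (κ x) v‖ := mul_le_mul_of_nonneg_right h4 h5
        _ = 2 * E * (β * ‖inner ℂ (κ x) v‖) := by ring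
        _ ≤ 2 * E * ‖v‖ := mul_le_mul_of_nonneg_left h1 (by positivity)
  · classical
    have hex : ∃ k, ¬ ∃ X : Fin k → α, (∀ i, X i ∈ S) ∧ (gramM fun i => κ (X i)).det ≠ 0 :=
      ⟨_, hP⟩
    have hk := Nat.find_spec hex
    have hle := Nat.find_min' hex hP
    have hmin := fun m => Nat.find_min hex (m := m)
    generalize Nat.find hex = k at hk hle hmin
    cases k with
    | zero =>
      exact absurd ⟨fun i => i.elim0, fun i => i.elim0, by simp⟩ hk
    | succ m =>
      obtain ⟨X, hXS, hXd⟩ := not_not.mp (hmin m (Nat.lt_succ_self m))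
      refine ⟨m, by omega, X, hXS, ?_⟩
      intro V hVf E hV hE v hv x hx
      have hE1 := hE0 V hVf E hE
      let Y : Fin (m + 1) → α := Fin.snoc X x
      have hYS : ∀ i, Y i ∈ S := by
        intro i
        refine Fin.lastCases ?_ (fun j => ?_) i
        · simpa [Y] using hx
        · simpa [Y] using hXS j
      have hYc : (fun i : Fin m => κ (Y i.castSucc)) = fun i => κ (X i) := by
        funext i; simp [Y]
      have hYv : ∀ i : Fin m, inner ℂ (κ (Y i.castSucc)) v = 0 := by
        intro i; simpa [Y] using hv i
      have hYl : κ (Y (Fin.last _)) = κ x := by simp [Y]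
      have hd : (gramM fun i => κ (Y i)).det = 0 := by
        by_contra hd
        exact hk ⟨Y, hYS, hd⟩
      have h := inner_last_zero (fun i => κ (Y i)) hd (by rw [hYc]; exact hXd) v hYv
      rw [hYl] at h
      rw [h, norm_zero]
      positivity

lemma finite_net {α : Type*} [TopologicalSpace α] (κ : α → H) (hκ : Continuous κ) (S : Set α)
    (hS : IsCompact S) (B : ℝ) (hB : 0 < B) :
    ∃ k, ∃ X : Fin k → α, (∀ i, X i ∈ S) ∧
      ∀ v, (∀ i, inner ℂ (κ (X i)) v = 0) → ∀ x ∈ S, ‖inner ℂ (κ x) v‖ ≤ B * ‖v‖ := by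
  obtain ⟨t, htS, htf, ht⟩ := (hS.image hκ).finite_cover_balls hB
  obtain ⟨k, f, -, hf⟩ := htf.fin_param
  have hfx : ∀ i, ∃ x ∈ S, κ x = f i := fun i => htS (hf ▸ Set.mem_range_self i)
  choose X hXS hXf using hfx
  refine ⟨k, X, hXS, fun v hv x hx => ?_⟩
  obtain ⟨y, hy, hxy⟩ := Set.mem_iUnion₂.mp (ht (Set.mem_image_of_mem κ hx))
  rw [← hf] at hy
  obtain ⟨i, rfl⟩ := hy
  rw [← hXf, mem_ball_iff_norm] at hxy
  have : inner ℂ (κ x) v = inner ℂ (κ x - κ (X i)) v := by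
    rw [inner_sub_left, hv, sub_zero]
  rw [this]
  exact (norm_inner_le_norm _ _).trans (mul_le_mul_of_nonneg_right hxy.le (norm_nonneg _))

end abstractPart

section concretePart

variable {d : ℕ}

def chr (k : Fin d → ℤ) (x : Fin d → ℝ) : ℂ :=
  Complex.exp (2 * Real.pi * Complex.I * ∑ j, (k j : ℂ) * (x j : ℂ))

lemma norm_chr (k : Fin d → ℤ) (x : Fin d → ℝ) : ‖chr k x‖ = 1 := by
  have : (2 * Real.pi * Complex.I * ∑ j, (k j : ℂ) * (x j : ℂ)) =
      ((2 * Real.pi * ∑ j, (k j : ℝ) * x j : ℝ) : ℂ) * Complex.I := by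
    push_cast; ring
  rw [chr, this, Complex.norm_exp_ofReal_mul_I]

lemma continuous_chr (k : Fin d → ℤ) : Continuous (chr k) := by
  unfold chr
  fun_prop

lemma kap_mem (ω : (Fin d → ℤ) → ℝ) (hs : Summable fun k => ((ω k) ^ 2)⁻¹) (x : Fin d → ℝ) :
    Memℓp (fun k : Fin d → ℤ => ((ω k : ℂ))⁻¹ * (starRingEnd ℂ) (chr k x)) 2 := by
  rw [memℓp_gen_iff (by norm_num)]
  refine hs.congr fun k => ?_
  rw [norm_mul, RCLike.norm_conj, norm_chr]
  simp

def kap (ω : (Fin d → ℤ) → ℝ) (hs : Summable fun k => ((ω k) ^ 2)⁻¹) (x : Fin d → ℝ) : Coef d :=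
  ⟨_, kap_mem ω hs x⟩

lemma kap_apply (ω : (Fin d → ℤ) → ℝ) (hs : Summable fun k => ((ω k) ^ 2)⁻¹) (x : Fin d → ℝ)
    (k : Fin d → ℤ) : kap ω hs x k = ((ω k : ℂ))⁻¹ * (starRingEnd ℂ) (chr k x) := rfl

lemma torusFn_eq (ω : (Fin d → ℤ) → ℝ) (hs : Summable fun k => ((ω k) ^ 2)⁻¹) (u : Coef d)
    (x : Fin d → ℝ) : torusFn ω u x = inner ℂ (kap ω hs x) u := by
  rw [lp.inner_eq_tsum, torusFn]
  refine tsum_congr fun k => ?_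
  rw [kap_apply, RCLike.inner_apply, map_mul, Complex.conj_conj, map_inv₀, Complex.conj_ofReal,
    chr]
  ring

lemma kap_norm_sq (ω : (Fin d → ℤ) → ℝ) (hs : Summable fun k => ((ω k) ^ 2)⁻¹) (x : Fin d → ℝ) :
    ‖kap ω hs x‖ ^ 2 = ∑' k, ((ω k) ^ 2)⁻¹ := by
  have h := lp.norm_rpow_eq_tsum (p := 2) (by norm_num) (kap ω hs x)
  simp only [ENNReal.toReal_ofNat, Real.rpow_ofNat] at h
  rw [h]
  refine tsum_congr fun k => ?_
  rw [kap_apply, norm_mul, RCLike.norm_conj, norm_chr]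
  simp

lemma continuous_kap (ω : (Fin d → ℤ) → ℝ) (hs : Summable fun k => ((ω k) ^ 2)⁻¹) :
    Continuous (kap ω hs) := by
  have h1 : ∀ y, Continuous fun x => (inner ℂ (kap ω hs x) (kap ω hs y) : ℂ) := by
    intro y
    simp_rw [← torusFn_eq]
    unfold torusFn
    refine continuous_tsum (u := fun k => ((ω k) ^ 2)⁻¹) (fun k => ?_) hs fun k x => ?_
    · exact continuous_const.mul (continuous_chr k)
    · change ‖_ * _ * chr k x‖ ≤ _
      rw [norm_mul, norm_mul, norm_chr, kap_apply, norm_mul, RCLike.norm_conj, norm_chr]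
      simp only [norm_inv, Complex.norm_real, Real.norm_eq_abs, mul_one]
      rw [← mul_inv, abs_mul_abs_self, sq]
  rw [continuous_iff_continuousAt]
  intro y
  rw [ContinuousAt, tendsto_iff_norm_sub_tendsto_zero]
  have h2 : ∀ x, ‖kap ω hs x - kap ω hs y‖ =
      √(2 * (∑' k, ((ω k) ^ 2)⁻¹) - 2 * RCLike.re (inner ℂ (kap ω hs x) (kap ω hs y) : ℂ)) := by
    intro x
    rw [← Real.sqrt_sq (norm_nonneg (kap ω hs x - kap ω hs y)), norm_sub_sq (𝕜 := ℂ),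
      kap_norm_sq, kap_norm_sq]
    congr 1
    ring
  have h3 : Continuous fun x => ‖kap ω hs x - kap ω hs y‖ := by
    simp_rw [h2]
    have := RCLike.continuous_re.comp (h1 y)
    exact (continuous_const.sub (continuous_const.mul this)).sqrt
  have := h3.tendsto y
  simpa using this

lemma isCompact_cube : IsCompact (cube d) := by
  have : cube d = Set.pi Set.univ fun _ => Set.Icc (0:ℝ) 1 := by
    ext x; simp only [cube, Set.mem_setOf_eq, Set.mem_pi, Set.mem_univ, true_imp_iff]
  rw [this]
  exact isCompact_univ_pi fun _ => isCompact_Icc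

lemma cube_nonempty : (cube d).Nonempty := ⟨fun _ => 0, fun _ => by simp⟩

lemma std_upper (ω : (Fin d → ℤ) → ℝ) (hs : Summable fun k => ((ω k) ^ 2)⁻¹) {k : ℕ}
    (X : Fin k → Fin d → ℝ) (hX : ∀ i, X i ∈ cube d) (B : ℝ) (hB : 0 ≤ B)
    (h : ∀ v, (∀ i, inner ℂ (kap ω hs (X i)) v = 0) → ∀ x ∈ cube d,
      ‖inner ℂ (kap ω hs x) v‖ ≤ B * ‖v‖) :
    wcErr ω (stdInfo ω) k ≤ ENNReal.ofReal (2 * B) := by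
  classical
  let inf : Coef d → Fin k → ℂ := fun u i => torusFn ω u (X i)
  let φ : (Fin k → ℂ) → (Fin d → ℝ) → ℂ := fun y =>
    if hy : ∃ u : Coef d, ‖u‖ ≤ 1 ∧ inf u = y then torusFn ω hy.choose else 0
  refine iInf_le_of_le (fun i u => torusFn ω u (X i)) (iInf_le_of_le (fun i => ⟨X i, hX i, rfl⟩)
    (iInf_le_of_le φ ?_))
  refine iSup_le fun u => iSup_le fun hu => iSup_le fun x => iSup_le fun hx => ?_
  have hy : ∃ w : Coef d, ‖w‖ ≤ 1 ∧ inf w = inf u := ⟨u, hu, rfl⟩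
  have hφ : φ (fun i => torusFn ω u (X i)) = torusFn ω hy.choose := dif_pos hy
  obtain ⟨hw1, hw2⟩ := hy.choose_spec
  rw [hφ]
  generalize hy.choose = w at hw1 hw2
  have h1 := h (u - w) (fun i => by
      have := congrFun hw2 i
      simp only [inf, torusFn_eq ω hs] at this
      rw [inner_sub_right, this, sub_self]) x hx
  rw [inner_sub_right, ← torusFn_eq, ← torusFn_eq] at h1
  have h2 : ‖u - w‖ ≤ 2 := (norm_sub_le u w).trans (by linarith)
  have h3 : ‖torusFn ω u x - torusFn ω w x‖ ≤ 2 * B := by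
    nlinarith
  rw [← enorm_eq_nnnorm, ← ofReal_norm_eq_enorm]
  exact ENNReal.ofReal_le_ofReal h3

lemma std_sub_all (ω : (Fin d → ℤ) → ℝ) (hs : Summable fun k => ((ω k) ^ 2)⁻¹) (n : ℕ) :
    wcErr ω (allInfo d) n ≤ wcErr ω (stdInfo ω) n := by
  refine le_iInf fun L => le_iInf fun hL => ?_
  refine iInf_le_of_le L (iInf_le_of_le (fun i => ?_) le_rfl)
  obtain ⟨x, -, hx⟩ := hL i
  refine ⟨innerSL ℂ (kap ω hs x), ?_⟩
  rw [hx]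
  funext u
  rw [torusFn_eq ω hs]; rfl

lemma std_le_all (ω : (Fin d → ℤ) → ℝ) (hs : Summable fun k => ((ω k) ^ 2)⁻¹) (n : ℕ) :
    ∃ k ≤ 2 * n, wcErr ω (stdInfo ω) k ≤ 4 * wcErr ω (allInfo d) n := by
  obtain ⟨k, hk, X, hXS, hX⟩ := std_of_all (kap ω hs) (continuous_kap ω hs) (cube d)
    isCompact_cube cube_nonempty n
  refine ⟨k, hk, ?_⟩
  rw [mul_comm]
  refine (ENNReal.div_le_iff (by norm_num) (by norm_num)).mp ?_
  refine le_iInf fun L => le_iInf fun hL => le_iInf fun φ => ?_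
  refine (ENNReal.div_le_iff (by norm_num) (by norm_num)).mpr ?_
  set M := ⨆ (u : Coef d) (_ : ‖u‖ ≤ 1) (x : Fin d → ℝ) (_ : x ∈ cube d),
      (‖torusFn ω u x - φ (fun i => L i u) x‖₊ : ℝ≥0∞) with hM
  by_cases hMt : M = ⊤
  · rw [hMt]; simp
  have hMle : ∀ u : Coef d, ‖u‖ ≤ 1 → ∀ x ∈ cube d,
      ‖torusFn ω u x - φ (fun i => L i u) x‖ ≤ M.toReal := by
    intro u hu x hx
    have h1 : (‖torusFn ω u x - φ (fun i => L i u) x‖₊ : ℝ≥0∞) ≤ M :=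
      le_iSup_of_le u (le_iSup_of_le hu (le_iSup_of_le x (le_iSup_of_le hx le_rfl)))
    have h2 := ENNReal.toReal_mono hMt h1
    simpa using h2
  choose T hT using hL
  -- functions with vanishing information
  have hzero : ∀ u : Coef d, ‖u‖ ≤ 1 → (∀ i, T i u = 0) → ∀ x ∈ cube d,
      ‖torusFn ω u x‖ ≤ M.toReal := by
    intro u hu h0 x hx
    have e1 : (fun i => L i u) = 0 := by funext i; rw [hT]; simpa using h0 i
    have e2 : (fun i => L i (-u)) = 0 := by funext i; rw [hT]; simpa using h0 i
    have h1 := hMle u hu x hx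
    have h2 := hMle (-u) (by rwa [norm_neg]) x hx
    rw [e1] at h1
    rw [e2, torusFn_eq ω hs (-u), inner_neg_right, ← torusFn_eq] at h2
    have h3 : ‖(2:ℂ) * torusFn ω u x‖ ≤ 2 * M.toReal := by
      have : (2:ℂ) * torusFn ω u x = (torusFn ω u x - φ 0 x) - (-torusFn ω u x - φ 0 x) := by ring
      rw [this]
      exact (norm_sub_le _ _).trans (by linarith)
    rw [norm_mul] at h3
    simp at h3
    linarith
  let r : Fin n → Coef d := fun i => (InnerProductSpace.toDual ℂ (Coef d)).symm (T i)
  have hr : ∀ i u, inner ℂ (r i) u = T i u := fun i u =>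
    InnerProductSpace.toDual_symm_apply
  let V : Submodule ℂ (Coef d) := Submodule.span ℂ (Set.range r)
  have hVf : FiniteDimensional ℂ V := FiniteDimensional.span_of_finite ℂ (Set.finite_range r)
  have hVn : Module.finrank ℂ V ≤ n := by
    have := finrank_range_le_card (R := ℂ) r
    rw [Fintype.card_fin] at this
    exact this
  have hE : ∀ x ∈ cube d, ‖kap ω hs x - V.starProjection (kap ω hs x)‖ ≤ M.toReal := by
    intro x hx
    set w := kap ω hs x - V.starProjection (kap ω hs x) with hw
    have hwV : w ∈ Vᗮ := Submodule.sub_starProjection_mem_orthogonal _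
    by_cases hw0 : w = 0
    · rw [hw0, norm_zero]; exact ENNReal.toReal_nonneg
    have hwn : ‖w‖ ≠ 0 := by simpa using hw0
    have hTw : ∀ i, T i w = 0 := fun i => by
      rw [← hr]
      exact (Submodule.mem_orthogonal V w).mp hwV _ (Submodule.subset_span ⟨i, rfl⟩)
    have h1 := hzero (((‖w‖⁻¹ : ℝ) : ℂ) • w) (by
        rw [norm_smul, Complex.norm_real, norm_inv, norm_norm, inv_mul_cancel₀ hwn])
      (fun i => by rw [map_smul, hTw, smul_zero]) x hx
    have h2 : inner ℂ (kap ω hs x) w = ((‖w‖ ^ 2 : ℝ) : ℂ) := by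
      have e : kap ω hs x = w + V.starProjection (kap ω hs x) := by rw [hw]; abel
      rw [e, inner_add_left, (Submodule.mem_orthogonal V w).mp hwV _
        (Submodule.starProjection_apply_mem _ _), add_zero, inner_self_eq_norm_sq_to_K]
      simp
    rw [torusFn_eq ω hs, inner_smul_right, h2, ← Complex.ofReal_mul, Complex.norm_real,
      Real.norm_of_nonneg (by positivity), sq, inv_mul_cancel_left₀ hwn] at h1
    exact h1
  have h := std_upper ω hs X hXS (2 * M.toReal) (by positivity) (fun v hv x hx => hX V hVf _ hVn hE v hv x hx)
  refine h.trans (le_of_eq ?_)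
  rw [← mul_assoc, ENNReal.ofReal_mul (by norm_num), ENNReal.ofReal_toReal hMt, mul_comm]
  norm_num

lemma std_nonempty (ω : (Fin d → ℤ) → ℝ) (hp : ∀ k, 0 < ω k)
    (hs : Summable fun k => ((ω k) ^ 2)⁻¹) (crit : Crit) (ε : ℝ) (hε : 0 < ε) :
    ∃ n, wcErr ω (stdInfo ω) n ≤ ENNReal.ofReal ε * CRI ω crit := by
  have hc : 0 < CRI ω crit := by
    cases crit with
    | ABS => simp [CRI]
    | NOR =>
      obtain ⟨x, hx⟩ := cube_nonempty (d := d)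
      have hn : ‖kap ω hs x‖ ≠ 0 := by
        rw [norm_ne_zero_iff]
        intro h0
        have := kap_apply ω hs x 0
        rw [h0] at this
        have h2 := congrArg norm this
        rw [norm_mul, RCLike.norm_conj, norm_chr] at h2
        have := (hp 0).ne'
        simp at h2
        exact this (abs_eq_zero.mp h2.symm)
      set u : Coef d := ((‖kap ω hs x‖⁻¹ : ℝ) : ℂ) • kap ω hs x with hu
      have hu1 : ‖u‖ ≤ 1 := by
        rw [hu, norm_smul, Complex.norm_real, norm_inv, norm_norm, inv_mul_cancel₀ hn]
      have hne : torusFn ω u x ≠ 0 := by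
        rw [torusFn_eq ω hs, hu, inner_smul_right]
        refine mul_ne_zero (by simpa using hn) ?_
        rw [Ne, inner_self_eq_zero]
        simpa using hn
      have : (0 : ℝ≥0∞) < (‖torusFn ω u x‖₊ : ℝ≥0∞) := by simpa [pos_iff_ne_zero] using hne
      exact this.trans_le
        (le_iSup_of_le u (le_iSup_of_le hu1 (le_iSup_of_le x (le_iSup_of_le hx le_rfl))))
  have hpos : 0 < ENNReal.ofReal ε * CRI ω crit :=
    ENNReal.mul_pos (by simpa using hε) hc.ne'
  obtain ⟨δ, hδ0, hδ⟩ := ENNReal.lt_iff_exists_nnreal_btwn.mp hpos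
  have hδ1 : (0:ℝ) < δ := by exact_mod_cast hδ0
  obtain ⟨k, X, hXS, hX⟩ := finite_net (kap ω hs) (continuous_kap ω hs) (cube d)
    isCompact_cube ((δ:ℝ) / 2) (by positivity)
  refine ⟨k, (std_upper ω hs X hXS _ (by positivity) hX).trans ?_⟩
  rw [mul_div_cancel₀ _ (by norm_num : (2:ℝ) ≠ 0), ENNReal.ofReal_coe_nnreal]
  exact hδ.le

lemma comp_all_le_std (ω : (Fin d → ℤ) → ℝ) (hp : ∀ k, 0 < ω k)
    (hs : Summable fun k => ((ω k) ^ 2)⁻¹) (crit : Crit) (ε : ℝ) (hε : 0 < ε) :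
    infoComp ω (allInfo d) crit ε ≤ infoComp ω (stdInfo ω) crit ε := by
  refine Nat.sInf_le ?_
  exact (std_sub_all ω hs _).trans (Nat.sInf_mem (std_nonempty ω hp hs crit ε hε))

lemma comp_std_le_all (ω : (Fin d → ℤ) → ℝ) (hp : ∀ k, 0 < ω k)
    (hs : Summable fun k => ((ω k) ^ 2)⁻¹) (crit : Crit) (ε : ℝ) (hε : 0 < ε) :
    infoComp ω (stdInfo ω) crit ε ≤ 2 * infoComp ω (allInfo d) crit (ε / 4) := by
  obtain ⟨n0, hn0⟩ := std_nonempty ω hp hs crit (ε / 4) (by positivity)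
  have hne : {n : ℕ | wcErr ω (allInfo d) n ≤ ENNReal.ofReal (ε / 4) * CRI ω crit}.Nonempty :=
    ⟨n0, (std_sub_all ω hs _).trans hn0⟩
  have hmem := Nat.sInf_mem hne
  obtain ⟨k, hk, hk2⟩ := std_le_all ω hs (infoComp ω (allInfo d) crit (ε / 4))
  refine (Nat.sInf_le ?_).trans hk
  refine hk2.trans ((mul_le_mul_right hmem 4).trans (le_of_eq ?_))
  rw [← mul_assoc]
  congr 1
  rw [show (4 : ℝ≥0∞) = ENNReal.ofReal 4 by norm_num, ← ENNReal.ofReal_mul (by norm_num)]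
  congr 1
  ring

end concretePart

/-- ALG-PT for `Λ^all` is equivalent to ALG-PT for `Λ^std`,
for the absolute or normalized error criterion. -/
theorem stmt3
    (ω : (d : ℕ) → (Fin d → ℤ) → ℝ)
    (hpos : ∀ d, 0 < d → ∀ k, 0 < ω d k)
    (hsum : ∀ d, 0 < d → Summable fun k => ((ω d k) ^ 2)⁻¹)
    (crit : Crit) :
    ALGPT (fun d ε => infoComp (ω d) (allInfo d) crit ε) ↔
      ALGPT (fun d ε => infoComp (ω d) (stdInfo (ω d)) crit ε) := by
  constructor
  · rintro ⟨C, hC, p, hp, q, hq, h⟩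
    refine ⟨2 * C * 4 ^ p, by positivity, p, hp, q, hq, fun d hd ε hε => ?_⟩
    have hε0 : 0 < ε := hε.1
    have h1 := h d hd (ε / 4) ⟨by linarith, by linarith [hε.2]⟩
    have h2 : (infoComp (ω d) (stdInfo (ω d)) crit ε : ℝ) ≤
        2 * (infoComp (ω d) (allInfo d) crit (ε / 4) : ℝ) := by
      exact_mod_cast comp_std_le_all (ω d) (hpos d hd) (hsum d hd) crit ε hε0
    have h3 : (ε / 4) ^ (-p) = 4 ^ p * ε ^ (-p) := by
      rw [Real.div_rpow hε0.le (by norm_num), Real.rpow_neg (by norm_num : (0:ℝ) ≤ 4),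
        div_inv_eq_mul, mul_comm]
    rw [h3] at h1
    refine h2.trans ((mul_le_mul_of_nonneg_left h1 (by norm_num)).trans (le_of_eq ?_))
    ring
  · rintro ⟨C, hC, p, hp, q, hq, h⟩
    refine ⟨C, hC, p, hp, q, hq, fun d hd ε hε => le_trans ?_ (h d hd ε hε)⟩
    exact_mod_cast comp_all_le_std (ω d) (hpos d hd) (hsum d hd) crit ε hε.1
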